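/- Let R be a commutative Noetherian local ring and x_1, …, x_n a strong sequence of exact zero-divisors on R. Then for every R-regular element α ∈ R, the images of x_1, …, x_n in R/αR form a strong sequence of exact zero-divisors on R/αR. -/

import Mathlib

/-- `(x, y)` is a pair of exact zero-divisors on the `R`-module `M`:
`M ≠ xM`, `x ∉ (0 :_R M)`, `(0 :_M x) = yM` and `(0 :_M y) = xM`. -/
def IsEZDPair (R : Type*) [CommRing R] (M : Type*) [AddCommGroup M] [Module R M]
    (x y : R) : Prop :=
  Ideal.span {x} • (⊤ : Submodule R M) ≠ ⊤ ∧
  (∃ m : M, x • m ≠ 0) ∧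
  Submodule.torsionBy R M x = Ideal.span {y} • (⊤ : Submodule R M) ∧
  Submodule.torsionBy R M y = Ideal.span {x} • (⊤ : Submodule R M)

/-- `x 0, …, x (n-1)` is a sequence of exact zero-divisors on `M` with twins
`y 0, …, y (n-1)`: each `(x i, y i)` is a pair of exact zero-divisors on
`M ⧸ (x 0, …, x (i-1))M`. -/
def IsEZDSeqWithTwins (R : Type*) [CommRing R] (M : Type*) [AddCommGroup M] [Module R M]
    {n : ℕ} (x y : Fin n → R) : Prop :=
  ∀ i : Fin n,
    IsEZDPair R (M ⧸ (Ideal.span (x '' {j | j < i}) • (⊤ : Submodule R M))) (x i) (y i)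

/-- `x 0, …, x (n-1)` is a sequence of exact zero-divisors on `M`. -/
def IsEZDSeq (R : Type*) [CommRing R] (M : Type*) [AddCommGroup M] [Module R M]
    {n : ℕ} (x : Fin n → R) : Prop :=
  ∀ i : Fin n, ∃ y : R,
    IsEZDPair R (M ⧸ (Ideal.span (x '' {j | j < i}) • (⊤ : Submodule R M))) (x i) y

/-- `x 0, …, x (n-1)` is a strong sequence of exact zero-divisors on `R` with twins
`y 0, …, y (n-1)`: it is a sequence of exact zero-divisors with these twins, and for
any choice of distinct indices `i₁, …, i_k` (encoded as a finset `s`) and any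
`j ∉ s`, `(x j, y j)` is a pair of exact zero-divisors on `R/(x i₁, …, x i_k)`. -/
def IsStrongEZDSeqWithTwins (R : Type*) [CommRing R] {n : ℕ} (x y : Fin n → R) : Prop :=
  IsEZDSeqWithTwins R R x y ∧
  ∀ (s : Finset (Fin n)) (j : Fin n), j ∉ s →
    IsEZDPair R (R ⧸ (Ideal.span (x '' ↑s) • (⊤ : Submodule R R))) (x j) (y j)

/-- `x 0, …, x (n-1)` is a strong sequence of exact zero-divisors on `R`. -/
def IsStrongEZDSeq (R : Type*) [CommRing R] {n : ℕ} (x : Fin n → R) : Prop :=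
  ∃ y : Fin n → R, IsStrongEZDSeqWithTwins R x y

universe u

theorem Submodule.mem_span_singleton_smul_top_quotient_iff {R : Type*} [CommRing R]
    (I : Ideal R) (x r : R) :
    (Submodule.Quotient.mk r : R ⧸ (I • (⊤ : Submodule R R))) ∈
        Ideal.span {x} • (⊤ : Submodule R (R ⧸ (I • (⊤ : Submodule R R)))) ↔
      ∃ c, r - x * c ∈ I := by
  rw [Submodule.ideal_span_singleton_smul, Submodule.mem_smul_pointwise_iff_exists]
  constructor
  · rintro ⟨b, -, hb⟩
    obtain ⟨c, rfl⟩ := Submodule.Quotient.mk_surjective _ b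
    rw [← Submodule.Quotient.mk_smul, eq_comm, Submodule.Quotient.eq] at hb
    exact ⟨c, by simpa using hb⟩
  · rintro ⟨c, hc⟩
    refine ⟨Submodule.Quotient.mk c, trivial, ?_⟩
    rw [← Submodule.Quotient.mk_smul, eq_comm, Submodule.Quotient.eq]
    simpa using hc

theorem Submodule.torsionBy_quotient_eq_span_singleton_smul_top_iff {R : Type*} [CommRing R]
    (I : Ideal R) (x y : R) :
    Submodule.torsionBy R (R ⧸ (I • (⊤ : Submodule R R))) x = Ideal.span {y} • ⊤ ↔
      ∀ r, x * r ∈ I ↔ ∃ c, r - y * c ∈ I := by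
  rw [SetLike.ext_iff, (Submodule.Quotient.mk_surjective _).forall]
  refine forall_congr' fun r => ?_
  rw [Submodule.mem_span_singleton_smul_top_quotient_iff, Submodule.mem_torsionBy_iff,
    ← Submodule.Quotient.mk_smul, Submodule.Quotient.mk_eq_zero]
  simp

theorem isEZDPair_quotient_iff {R : Type*} [CommRing R] (I : Ideal R) (x y : R) :
    IsEZDPair R (R ⧸ (I • (⊤ : Submodule R R))) x y ↔
      (¬ ∃ c, 1 - x * c ∈ I) ∧ x ∉ I ∧
        (∀ r, x * r ∈ I ↔ ∃ c, r - y * c ∈ I) ∧ (∀ r, y * r ∈ I ↔ ∃ c, r - x * c ∈ I) := by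
  unfold IsEZDPair
  rw [Submodule.torsionBy_quotient_eq_span_singleton_smul_top_iff,
    Submodule.torsionBy_quotient_eq_span_singleton_smul_top_iff]
  refine and_congr (not_congr ?_) (and_congr ?_ Iff.rfl)
  · rw [Submodule.eq_top_iff', (Submodule.Quotient.mk_surjective _).forall]
    simp only [Submodule.mem_span_singleton_smul_top_quotient_iff]
    refine ⟨fun h => h 1, fun ⟨c, hc⟩ r => ⟨c * r, ?_⟩⟩
    convert I.mul_mem_right r hc using 1
    ring
  · rw [(Submodule.Quotient.mk_surjective _).exists]
    simp only [← Submodule.Quotient.mk_smul, ne_eq, Submodule.Quotient.mk_eq_zero]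
    simp only [smul_eq_mul, Ideal.mul_top]
    exact ⟨fun ⟨m, hm⟩ hx => hm (I.mul_mem_right m hx), fun hx => ⟨1, by simpa using hx⟩⟩

theorem Ideal.mem_map_quotientMk_span_singleton_iff {R : Type*} [CommRing R]
    (I : Ideal R) (α r : R) :
    Ideal.Quotient.mk (Ideal.span {α}) r ∈ I.map (Ideal.Quotient.mk (Ideal.span {α})) ↔
      ∃ c, r - α * c ∈ I := by
  rw [Ideal.mem_map_iff_of_surjective _ Ideal.Quotient.mk_surjective]
  constructor
  · rintro ⟨a, ha, har⟩
    obtain ⟨c, hc⟩ := Ideal.mem_span_singleton.1 (Ideal.Quotient.eq.1 har.symm)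
    exact ⟨c, by rwa [← hc, sub_sub_cancel]⟩
  · rintro ⟨c, hc⟩
    refine ⟨_, hc, Ideal.Quotient.eq.2 (Ideal.mem_span_singleton.2 ⟨-c, by ring⟩)⟩

/-- If `x` is an exact zero-divisor modulo `I`, then an element regular modulo `I` is also regular
modulo `(x) + I`. -/
theorem IsEZDPair.mem_of_mul_mem {R : Type*} [CommRing R] {I : Ideal R} {x y : R}
    (h : IsEZDPair R (R ⧸ (I • (⊤ : Submodule R R))) x y) {α : R}
    (hα : ∀ r, α * r ∈ I → r ∈ I) {r : R} (hr : α * r ∈ Ideal.span {x} ⊔ I) :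
    r ∈ Ideal.span {x} ⊔ I := by
  obtain ⟨-, -, -, hy⟩ := (isEZDPair_quotient_iff I x y).1 h
  obtain ⟨c, b, hb, hcb⟩ := Ideal.mem_span_singleton_sup.1 hr
  obtain ⟨d, hd⟩ := (hy r).1 <| hα _ <| by
    have := (hy (α * r)).2 ⟨c, by rw [← hcb]; convert hb using 1; ring⟩
    rwa [mul_left_comm] at this
  exact Ideal.mem_span_singleton_sup.2 ⟨d, _, hd, by ring⟩

theorem IsEZDPair.torsion_quotient_regular {R : Type*} [CommRing R] {I : Ideal R} {x y α : R}
    (hx : ∀ r, x * r ∈ I ↔ ∃ c, r - y * c ∈ I) (hy : ∀ r, y * r ∈ I ↔ ∃ c, r - x * c ∈ I)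
    (hα : ∀ r, α * r ∈ I → r ∈ I) (r : R) :
    (∃ c, x * r - α * c ∈ I) ↔ ∃ c d, r - y * c - α * d ∈ I := by
  have hyx : y * x ∈ I := (hy x).2 ⟨1, by simp⟩
  constructor
  · rintro ⟨c, hc⟩
    obtain ⟨d, hd⟩ := (hy c).1 <| hα _ <| by
      convert I.sub_mem (I.mul_mem_right r hyx) (I.mul_mem_left y hc) using 1
      ring
    obtain ⟨e, he⟩ := (hx (r - α * d)).1 <| by
      convert I.add_mem hc (I.mul_mem_left α hd) using 1
      ring
    exact ⟨e, d, by convert he using 1; ring⟩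
  · rintro ⟨c, d, hcd⟩
    refine ⟨x * d, ?_⟩
    convert I.add_mem (I.mul_mem_left x hcd) (I.mul_mem_right c hyx) using 1
    ring

theorem IsEZDPair.quotient_regular {R : Type*} [CommRing R] [IsLocalRing R] {I : Ideal R}
    {x y : R} (h : IsEZDPair R (R ⧸ (I • (⊤ : Submodule R R))) x y) {α : R}
    (hα : ∀ r, α * r ∈ I → r ∈ I) (hnu : ¬ IsUnit α) :
    IsEZDPair (R ⧸ Ideal.span {α})
      ((R ⧸ Ideal.span {α}) ⧸ (I.map (Ideal.Quotient.mk (Ideal.span {α})) •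
        (⊤ : Submodule (R ⧸ Ideal.span {α}) (R ⧸ Ideal.span {α}))))
      (Ideal.Quotient.mk _ x) (Ideal.Quotient.mk _ y) := by
  obtain ⟨hne, hxI, hx, hy⟩ := (isEZDPair_quotient_iff I x y).1 h
  have isUnit_one_sub (d : R) : IsUnit (1 - α * d) :=
    IsLocalRing.isUnit_one_sub_self_of_mem_nonunits _ fun hu => hnu (isUnit_of_mul_isUnit_left hu)
  rw [isEZDPair_quotient_iff]
  simp only [Ideal.Quotient.mk_surjective.forall, Ideal.Quotient.mk_surjective.exists,
    ← map_mul, ← map_one (Ideal.Quotient.mk (Ideal.span {α})), ← map_sub,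
    Ideal.mem_map_quotientMk_span_singleton_iff]
  refine ⟨?_, ?_, torsion_quotient_regular hx hy hα, torsion_quotient_regular hy hx hα⟩
  · rintro ⟨c, d, hcd⟩
    obtain ⟨v, hv⟩ := (isUnit_one_sub d).exists_right_inv
    refine hne ⟨c * v, ?_⟩
    convert I.mul_mem_right v hcd using 1
    linear_combination -hv
  · rintro ⟨c, hc⟩
    have hyx : y * x ∈ I := (hy x).2 ⟨1, by simp⟩
    obtain ⟨d, hd⟩ := (hy c).1 <| hα _ <| by
      convert I.sub_mem hyx (I.mul_mem_left y hc) using 1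
      ring
    refine hxI ((I.unit_mul_mem_iff_mem (isUnit_one_sub d)).1 ?_)
    convert I.add_mem hc (I.mul_mem_left α hd) using 1
    ring

theorem IsStrongEZDSeqWithTwins.mem_of_mul_mem {R : Type*} [CommRing R] {n : ℕ}
    {x y : Fin n → R} (h : IsStrongEZDSeqWithTwins R x y) {α : R}
    (hreg : α ∈ nonZeroDivisors R) (s : Finset (Fin n)) :
    ∀ r, α * r ∈ Ideal.span (x '' ↑s) → r ∈ Ideal.span (x '' ↑s) := by
  induction s using Finset.induction_on with
  | empty =>
    intro r hr
    simp only [Finset.coe_empty, Set.image_empty, Ideal.span_empty, Ideal.mem_bot] at hr ⊢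
    exact (mul_left_mem_nonZeroDivisors_eq_zero_iff hreg).1 hr
  | insert j s hj ih =>
    intro r hr
    rw [Finset.coe_insert, Set.image_insert_eq, Ideal.span_insert] at hr ⊢
    exact (h.2 s j hj).mem_of_mul_mem ih hr

/-- If `x 0, …, x (n-1)` is a strong sequence of exact zero-divisors on a Noetherian
local ring `R` and `α` is an `R`-regular element (a non-zerodivisor non-unit), then
the images of the `x i` in `R/αR` form a strong sequence of exact zero-divisors. -/
theorem isStrongEZDSeq_quotient_regular
    (R : Type u) [CommRing R] [IsNoetherianRing R] [IsLocalRing R]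
    {n : ℕ} (x : Fin n → R) (h : IsStrongEZDSeq R x)
    (α : R) (hreg : α ∈ nonZeroDivisors R) (hnu : ¬ IsUnit α) :
    IsStrongEZDSeq (R ⧸ Ideal.span {α})
      (fun i => Ideal.Quotient.mk (Ideal.span {α}) (x i)) := by
  obtain ⟨y, hxy⟩ := h
  have map_span (s : Finset (Fin n)) :
      Ideal.span ((fun i => Ideal.Quotient.mk (Ideal.span {α}) (x i)) '' ↑s) =
        (Ideal.span (x '' ↑s)).map (Ideal.Quotient.mk (Ideal.span {α})) := by
    rw [Ideal.map_span, Set.image_image]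
  have key (s : Finset (Fin n)) (j : Fin n) (hj : j ∉ s) :
      IsEZDPair (R ⧸ Ideal.span {α})
        ((R ⧸ Ideal.span {α}) ⧸
          (Ideal.span ((fun i => Ideal.Quotient.mk (Ideal.span {α}) (x i)) '' ↑s) •
            (⊤ : Submodule (R ⧸ Ideal.span {α}) (R ⧸ Ideal.span {α}))))
        (Ideal.Quotient.mk _ (x j)) (Ideal.Quotient.mk _ (y j)) := by
    rw [map_span]
    exact (hxy.2 s j hj).quotient_regular (hxy.mem_of_mul_mem hreg s) hnu
  refine ⟨fun i => Ideal.Quotient.mk _ (y i), fun i => ?_, key⟩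
  have hi := key (Finset.univ.filter (· < i)) i (by simp)
  rw [Finset.coe_filter_univ] at hi
  exact hi
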